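/- Let K be a field, σ an automorphism of K with fixed field E, and suppose a ∈ K is such that E(σⁿ(a) : n ∈ ℕ) is infinitely generated over E. Fix n ≥ 1, and in D = K(x,σ) set Aᵢ = 1 + σ^i(a)x^{2n} for 0 ≤ i ≤ n. Then A₀, A₁, …, Aₙ freely generate a free subgroup of D* of rank n+1. -/

import Mathlib

namespace Stmt9

section Magnus

variable {ι F : Type*} [DecidableEq ι] [Field F]

/-- left multiplication by `1 + Y_i` on noncommutative power series -/
def fwd (i : ι) (s : List ι → F) : List ι → F
  | [] => s []
  | j :: w => s (j :: w) + if i = j then s w else 0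

/-- left multiplication by `(1 + Y_i)⁻¹` -/
def bwd (i : ι) (s : List ι → F) : List ι → F
  | [] => s []
  | j :: w => s (j :: w) - if i = j then bwd i s w else 0

theorem bwd_fwd (i : ι) (s : List ι → F) : bwd i (fwd i s) = s := by
  funext w
  induction w with
  | nil => rfl
  | cons j w ih => simp only [bwd, fwd, ih]; ring

theorem fwd_bwd (i : ι) (s : List ι → F) : fwd i (bwd i s) = s := by
  funext w
  cases w with
  | nil => rfl
  | cons j w => simp only [bwd, fwd]; ring

/-- The permutation `1 + Y_i`. -/
def perm (F : Type*) [Field F] (i : ι) : Equiv.Perm (List ι → F) where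
  toFun := fwd i
  invFun := bwd i
  left_inv := bwd_fwd i
  right_inv := fwd_bwd i

/-- number of syllables -/
def syll : List ι → ℕ
  | [] => 0
  | i :: w => if w.head? = some i then syll w else syll w + 1

theorem syll_rep (i : ι) (v : List ι) (hv : v.head? ≠ some i) (k : ℕ) :
    syll (List.replicate (k + 1) i ++ v) = syll v + 1 := by
  induction k with
  | zero => simp [syll, hv]
  | succ k ih =>
    rw [List.replicate_succ, List.cons_append, syll, if_pos, ih]
    simp [List.replicate_succ]

theorem decomp (i : ι) (w : List ι) :
    ∃ k v, w = List.replicate k i ++ v ∧ v.head? ≠ some i := by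
  induction w with
  | nil => exact ⟨0, [], by simp⟩
  | cons j w ih =>
    by_cases h : j = i
    · subst h
      obtain ⟨k, v, rfl, hv⟩ := ih
      exact ⟨k + 1, v, by simp [List.replicate_succ], hv⟩
    · exact ⟨0, j :: w, by simp, by simpa using h⟩

/-- The power series of coefficients at `i^k v`. -/
noncomputable def ser (i : ι) (v : List ι) (s : List ι → F) : PowerSeries F :=
  PowerSeries.mk fun k => s (List.replicate k i ++ v)

theorem ser_fwd (i : ι) (v : List ι) (hv : v.head? ≠ some i) (s : List ι → F) :
    ser i v (perm F i s) = (1 + PowerSeries.X) * ser i v s := by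
  ext k
  rw [add_mul, one_mul, map_add]
  cases k with
  | zero =>
    cases v with
    | nil => simp [ser, perm, fwd]
    | cons j v =>
      have : ¬ i = j := fun h => hv (by simp [h])
      simp [ser, perm, fwd, this]
  | succ k =>
    rw [PowerSeries.coeff_succ_X_mul]
    simp [ser, perm, fwd, List.replicate_succ]

theorem isUnit_U : IsUnit (1 + PowerSeries.X : PowerSeries F) := by
  rw [PowerSeries.isUnit_iff_constantCoeff]; simp

/-- `1 + X` as a unit -/
noncomputable def U (F : Type*) [Field F] : (PowerSeries F)ˣ := (isUnit_U (F := F)).unit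

theorem U_val : (U F : PowerSeries F) = 1 + PowerSeries.X := rfl

theorem ser_zpow (i : ι) (v : List ι) (hv : v.head? ≠ some i) (m : ℤ) (s : List ι → F) :
    ser i v ((perm F i ^ m) s) = ((U F ^ m : (PowerSeries F)ˣ) : PowerSeries F) * ser i v s := by
  induction m using Int.induction_on with
  | zero => simp
  | succ m ih =>
    rw [add_comm, zpow_one_add, zpow_one_add, Equiv.Perm.mul_apply, ser_fwd _ _ hv, ih,
      Units.val_mul, U_val, mul_assoc]
  | pred m ih =>
    have h1 : (perm F i ^ (-(m:ℤ))) = perm F i * (perm F i ^ (-(m:ℤ) - 1)) := by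
      rw [← zpow_one_add]; congr 1; ring
    have h2 : (U F ^ (-(m:ℤ))) = U F * (U F ^ (-(m:ℤ) - 1)) := by
      rw [← zpow_one_add]; congr 1; ring
    rw [h1, h2, Equiv.Perm.mul_apply, ser_fwd _ _ hv, Units.val_mul, mul_assoc, U_val] at ih
    exact isUnit_U.mul_left_cancel ih

theorem U_pow_ne (m : ℕ) (hm : m ≠ 0) : U F ^ m ≠ 1 := by
  intro h
  have h1 : (1 + PowerSeries.X : PowerSeries F) ^ m = 1 := by
    have := congrArg (Units.val) h
    simpa [U_val] using this
  have h2 : ((1 + Polynomial.X : Polynomial F) ^ m) = 1 := by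
    apply Polynomial.coe_injective F
    simpa using h1
  have h3 := congrArg Polynomial.natDegree h2
  rw [Polynomial.natDegree_pow, show (1 + Polynomial.X : Polynomial F) = Polynomial.X + Polynomial.C 1 by
    simp [add_comm], Polynomial.natDegree_X_add_C] at h3
  simp at h3
  exact hm h3

theorem U_zpow_ne (m : ℤ) (hm : m ≠ 0) : U F ^ m ≠ 1 := by
  intro h
  apply U_pow_ne (F := F) m.natAbs (by simpa using hm)
  rcases Int.natAbs_eq m with h' | h'
  · rw [h'] at h; simpa using h
  · rw [h'] at h; simpa using h

theorem U_constCoeff (m : ℤ) :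
    PowerSeries.constantCoeff ((U F ^ m : (PowerSeries F)ˣ) : PowerSeries F) = 1 := by
  have h : (Units.map (PowerSeries.constantCoeff (R := F)).toMonoidHom) (U F) = 1 := by
    ext; simp [U_val]
  have h2 : (Units.map (PowerSeries.constantCoeff (R := F)).toMonoidHom) (U F ^ m) = 1 := by
    rw [map_zpow, h, one_zpow]
  exact congrArg Units.val h2

theorem U_coeff (m : ℤ) (hm : m ≠ 0) :
    ∃ k, PowerSeries.coeff (k + 1) ((U F ^ m : (PowerSeries F)ˣ) : PowerSeries F) ≠ 0 := by
  by_contra! h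
  apply U_zpow_ne (F := F) m hm
  ext k
  cases k with
  | zero => simpa using U_constCoeff (F := F) m
  | succ k => rw [h k]; simp [PowerSeries.coeff_one]

/-- Ping-pong set. -/
def Z (i : ι) (t : ℕ) (s : List ι → F) : Prop :=
  (∀ w, s w ≠ 0 → syll w ≤ t) ∧ ∃ w, s w ≠ 0 ∧ syll w = t ∧ w.head? ≠ some i

theorem Z_step (i : ι) (t : ℕ) (s : List ι → F) (h : Z i t s) (m : ℤ) (hm : m ≠ 0)
    (j : ι) (hj : j ≠ i) : Z j (t + 1) ((perm F i ^ m) s) := by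
  obtain ⟨h1, w, hw, hwt, hwi⟩ := h
  constructor
  · intro w'
    contrapose!
    intro hlt
    obtain ⟨k, v, rfl, hv⟩ := decomp i w'
    have hs : ∀ k, syll (List.replicate k i ++ v) ≤ syll v + 1 ∧
        syll v ≤ syll (List.replicate k i ++ v) := by
      intro k
      cases k with
      | zero => simp
      | succ k => rw [syll_rep i v hv]; omega
    have h0 : ser i v s = 0 := by
      ext l
      simp only [ser, PowerSeries.coeff_mk, map_zero]
      by_contra hne
      have := h1 _ hne
      have := hs k
      have := hs l
      omega
    have := ser_zpow i v hv m s
    rw [h0, mul_zero] at this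
    have := congrArg (PowerSeries.coeff k) this
    simpa [ser] using this
  · obtain ⟨k, hk⟩ := U_coeff (F := F) m hm
    refine ⟨List.replicate (k + 1) i ++ w, ?_, ?_, ?_⟩
    · have h0 : ser i w s = PowerSeries.C (s w) := by
        ext l
        cases l with
        | zero => simp [ser]
        | succ l =>
          simp only [ser, PowerSeries.coeff_mk]
          rw [PowerSeries.coeff_C, if_neg (by omega)]
          by_contra hne
          have := h1 _ hne
          rw [syll_rep i w hwi] at this
          omega
      have := ser_zpow i w hwi m s
      rw [h0] at this
      have := congrArg (PowerSeries.coeff (k + 1)) this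
      rw [PowerSeries.coeff_mul_C] at this
      simp only [ser, PowerSeries.coeff_mk] at this
      rw [this]
      exact mul_ne_zero hk hw
    · rw [syll_rep i w hwi, hwt]
    · simp [List.replicate_succ, hj.symm]

/-- the series `1` -/
def one (ι F : Type*) [Field F] : List ι → F
  | [] => 1
  | _ :: _ => 0

theorem Z_one (i : ι) : Z i 0 (one ι F) := by
  constructor
  · intro w; cases w <;> simp [one, syll]
  · exact ⟨[], by simp [one], rfl, by simp⟩

/-- The Magnus action. -/
def Psi (ι F : Type*) [DecidableEq ι] [Field F] : FreeGroup ι →* Equiv.Perm (List ι → F) :=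
  FreeGroup.lift (perm F)

theorem word_Z (w : Monoid.CoprodI.Word (fun _ : ι => FreeGroup Unit)) :
    ∃ t, (t = 0 → w = Monoid.CoprodI.Word.empty) ∧ ∀ i, w.fstIdx ≠ some i →
      Z i t ((Psi ι F (freeGroupEquivCoprodI.symm w.prod)) (one ι F)) := by
  induction w using Monoid.CoprodI.Word.consRecOn with
  | empty =>
    refine ⟨0, fun _ => rfl, fun i _ => ?_⟩
    simpa using Z_one i
  | cons i m w h1 h2 ih =>
    obtain ⟨t, -, ht⟩ := ih
    refine ⟨t + 1, by simp, fun j hj => ?_⟩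
    have hji : j ≠ i := by
      rintro rfl
      simp at hj
    obtain ⟨k, rfl⟩ : ∃ k : ℤ, FreeGroup.of () ^ k = m :=
      ⟨FreeGroup.freeGroupUnitEquivInt m, FreeGroup.freeGroupUnitEquivInt.symm_apply_apply m⟩
    have hk : k ≠ 0 := by rintro rfl; simp at h2
    have := Z_step i t _ (ht i h1) k hk j hji
    rw [Monoid.CoprodI.Word.prod_cons, map_mul, map_mul, Equiv.Perm.mul_apply]
    convert this using 3
    simp [Psi, freeGroupEquivCoprodI]

theorem Psi_one_ne (g : FreeGroup ι) (h : Psi ι F g (one ι F) = one ι F) (i : ι) (i' : ι) (hii : i ≠ i') : g = 1 := by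
  obtain ⟨w, hw⟩ : ∃ w : Monoid.CoprodI.Word (fun _ : ι => FreeGroup Unit),
      freeGroupEquivCoprodI.symm w.prod = g := by
    classical
    refine ⟨Monoid.CoprodI.Word.equiv (freeGroupEquivCoprodI g), ?_⟩
    have : (Monoid.CoprodI.Word.equiv (freeGroupEquivCoprodI g)).prod = freeGroupEquivCoprodI g :=
      Monoid.CoprodI.Word.equiv.symm_apply_apply _
    rw [this]; exact freeGroupEquivCoprodI.symm_apply_apply g
  obtain ⟨t, ht, hZ⟩ := word_Z (F := F) w
  rw [hw, h] at hZ
  have : ∃ j, w.fstIdx ≠ some j := by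
    by_contra! hc
    have := (hc i).symm.trans (hc i')
    exact hii (by simpa using this)
  obtain ⟨j, hj⟩ := this
  obtain ⟨-, v, hv, hvt, -⟩ := hZ j hj
  cases v with
  | nil =>
    rw [← hw, ht hvt.symm]; simp
  | cons _ _ => simp [one] at hv

end Magnus

section LocFin

variable {K Q : Type*} [Field K] [AddCommGroup Q] [Module K Q] {ρ : K →+* K}

/-- `p` lies in a finite dimensional `T`-stable subspace -/
def LocFin (T : Q →ₛₗ[ρ] Q) (p : Q) : Prop :=
  ∃ V : Submodule K Q, V.FG ∧ p ∈ V ∧ ∀ v ∈ V, T v ∈ V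

theorem LocFin.zero (T : Q →ₛₗ[ρ] Q) : LocFin T 0 :=
  ⟨⊥, Submodule.fg_bot, by simp, by simp⟩

theorem LocFin.step (T : Q →ₛₗ[ρ] Q) (p p' : Q) (c c' : K) (h : LocFin T p)
    (hp : T p' = T p + c • p + c' • p') : LocFin T p' := by
  obtain ⟨V, hV, hpV, hT⟩ := h
  refine ⟨V ⊔ Submodule.span K {p'}, hV.sup (Submodule.fg_span_singleton p'), ?_, ?_⟩
  · exact Submodule.mem_sup_right (Submodule.mem_span_singleton_self p')
  · have hp' : p' ∈ V ⊔ Submodule.span K {p'} :=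
      Submodule.mem_sup_right (Submodule.mem_span_singleton_self p')
    change V ⊔ Submodule.span K {p'} ≤ (V ⊔ Submodule.span K {p'}).comap T
    refine sup_le (fun v hv => Submodule.mem_sup_left (hT v hv)) ?_
    rw [Submodule.span_singleton_le_iff_mem, Submodule.mem_comap, hp]
    exact add_mem (add_mem (Submodule.mem_sup_left (hT p hpV))
      (Submodule.smul_mem _ _ (Submodule.mem_sup_left hpV))) (Submodule.smul_mem _ _ hp')

theorem LocFin.not_li (T : Q →ₛₗ[ρ] Q) (p : Q) (h : LocFin T p) (u : ℕ → Q) (h0 : u 0 = p)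
    (hu : ∀ k, u (k + 1) = T (u k)) : ¬ LinearIndependent K u := by
  obtain ⟨V, hV, hpV, hT⟩ := h
  intro hli
  have hm : ∀ k, u k ∈ V := by
    intro k
    induction k with
    | zero => rw [h0]; exact hpV
    | succ k ih => rw [hu]; exact hT _ ih
  have : Module.Finite K V := Module.Finite.iff_fg.mpr hV
  have h2 : LinearIndependent K (fun k => (⟨u k, hm k⟩ : V)) :=
    LinearIndependent.of_comp V.subtype hli
  have := h2.finite
  exact not_finite ℕ

end LocFin

section Shift

variable {K : Type*} [Field K]

/-- The action of `y⁻¹` on Laurent series. -/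
def shift (τ : K ≃+* K) : (ℤ → K) →ₛₗ[(τ.symm : K →+* K)] (ℤ → K) where
  toFun s k := τ.symm (s (k + 1))
  map_add' s t := by ext k; simp
  map_smul' c s := by ext k; simp

theorem shift_li (τ : K ≃+* K) (z : ℤ → K) (m : ℤ) (hm : z m ≠ 0) (hlt : ∀ k < m, z k = 0) :
    LinearIndependent K (fun k : ℕ => (shift τ)^[k] z) := by
  have hform : ∀ (k : ℕ) (l : ℤ), (z (l + k) = 0 ↔ (shift τ)^[k] z l = 0) := by
    intro k
    induction k with
    | zero => simp
    | succ k ih =>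
      intro l
      rw [Function.iterate_succ_apply']
      change _ ↔ τ.symm ((shift τ)^[k] z (l + 1)) = 0
      rw [map_eq_zero_iff _ τ.symm.injective, ← ih]
      push_cast
      rw [show l + 1 + (k : ℤ) = l + (k + 1) by ring]
  rw [linearIndependent_iff']
  intro s g hg
  by_contra! hc
  classical
  obtain ⟨i0, hi0, hgi0⟩ := hc
  have hne : (s.filter fun i => g i ≠ 0).Nonempty := ⟨i0, by simp [hi0, hgi0]⟩
  obtain ⟨i, hi, hmax⟩ := Finset.exists_max_image _ id hne
  rw [Finset.mem_filter] at hi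
  have h1 := congrFun hg (m - i)
  rw [Finset.sum_apply, Finset.sum_eq_single i] at h1
  · simp only [Pi.smul_apply, smul_eq_mul, Pi.zero_apply, mul_eq_zero] at h1
    rcases h1 with h1 | h1
    · exact hi.2 h1
    · rw [← hform] at h1
      exact hm (by simpa using h1)
  · intro j hj hji
    by_cases hgj : g j = 0
    · simp [hgj]
    · have hle : j ≤ i := hmax j (by simp [hj, hgj])
      have : (shift τ)^[j] z (m - i) = 0 := by
        rw [← hform]
        apply hlt
        omega
      simp [this]
  · intro h; exact absurd hi.1 h

end Shift

section Eval

variable {ι K : Type*} [Fintype ι] [Field K]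

/-- Degree `k` part of the evaluation `Y_i ↦ a_i y`. -/
def evk (E : Subfield K) (τ : K ≃+* K) (α : ι → K) : ℕ → (List ι → E) → K
  | 0, s => (s [] : K)
  | k + 1, s => ∑ i, α i * τ (evk E τ α k (fun w => s (i :: w)))

variable (E : Subfield K) (τ : K ≃+* K) (α : ι → K)

theorem evk_succ (k : ℕ) (s : List ι → E) :
    evk E τ α (k + 1) s = ∑ i, α i * τ (evk E τ α k (fun w => s (i :: w))) := rfl

theorem evk_add (k : ℕ) (s t : List ι → E) :
    evk E τ α k (s + t) = evk E τ α k s + evk E τ α k t := by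
  induction k generalizing s t with
  | zero => simp [evk]
  | succ k ih =>
    have : ∀ i : ι, (fun w => (s + t) (i :: w)) = (fun w => s (i :: w)) + (fun w => t (i :: w)) :=
      fun i => rfl
    simp only [evk, this, ih, map_add, mul_add, Finset.sum_add_distrib]

theorem evk_zero (k : ℕ) : evk E τ α k 0 = 0 := by
  have := evk_add E τ α k 0 0
  simpa using this

theorem evk_sub (k : ℕ) (s t : List ι → E) :
    evk E τ α k (s - t) = evk E τ α k s - evk E τ α k t := by
  rw [eq_sub_iff_add_eq, ← evk_add, sub_add_cancel]

theorem evk_fwd [DecidableEq ι] (k : ℕ) (i : ι) (s : List ι → E) :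
    evk E τ α (k + 1) (fwd i s) = evk E τ α (k + 1) s + α i * τ (evk E τ α k s) := by
  have : ∀ j : ι, (fun w => fwd i s (j :: w)) =
      (fun w => s (j :: w)) + (if i = j then s else 0) := by
    intro j
    funext w
    simp only [fwd, Pi.add_apply]
    split_ifs <;> rfl
  simp only [evk, this, evk_add, map_add, mul_add, Finset.sum_add_distrib]
  congr 1
  rw [Finset.sum_eq_single i]
  · simp
  · intro j _ hj
    rw [if_neg hj.symm, evk_zero]; simp
  · simp

theorem evk_last (hτ : ∀ e : E, τ e = e) (k : ℕ) (s : List ι → E) :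
    evk E τ α (k + 1) s = ∑ i, evk E τ α k (fun w => s (w ++ [i])) * (τ ^ k) (α i) := by
  induction k generalizing s with
  | zero => simp [evk, hτ, mul_comm]
  | succ k ih =>
    rw [evk_succ]
    conv_lhs => simp only [ih, map_sum, Finset.mul_sum]
    rw [Finset.sum_comm]
    refine Finset.sum_congr rfl fun i _ => ?_
    rw [evk_succ, Finset.sum_mul]
    refine Finset.sum_congr rfl fun j _ => ?_
    rw [map_mul, pow_succ']
    simp [mul_assoc]

/-- Evaluation of a noncommutative power series as a Laurent series. -/
def ev (s : List ι → E) : ℤ → K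
  | Int.ofNat k => evk E τ α k s
  | Int.negSucc _ => 0

theorem ev_fwd [DecidableEq ι] (i : ι) (s : List ι → E) :
    shift τ (ev E τ α (fwd i s)) = shift τ (ev E τ α s) + τ.symm (α i) • ev E τ α s := by
  funext k
  change τ.symm (ev E τ α (fwd i s) (k + 1)) =
    τ.symm (ev E τ α s (k + 1)) + τ.symm (α i) * ev E τ α s k
  rcases k with k | k
  · change τ.symm (evk E τ α (k + 1) (fwd i s)) =
      τ.symm (evk E τ α (k + 1) s) + τ.symm (α i) * evk E τ α k s
    rw [evk_fwd]; simp
  · rcases k with _ | k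
    · change τ.symm (evk E τ α 0 (fwd i s)) = τ.symm (evk E τ α 0 s) + τ.symm (α i) * 0
      simp [evk, fwd]
    · change τ.symm 0 = τ.symm 0 + τ.symm (α i) * 0
      simp

end Eval

section Field

variable {K : Type*} [Field K] (σ : K ≃+* K) (E : Subfield K) (a : K)

/-- `E(a, …, σ^{m-1} a)` -/
def Fl (m : ℕ) : Subfield K :=
  Subfield.closure ((E : Set K) ∪ (fun n : ℕ => (σ ^ n) a) '' {j | j < m})

theorem E_le_Fl (m : ℕ) : ∀ e ∈ E, e ∈ Fl σ E a m := fun e he =>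
  Subfield.subset_closure (Or.inl he)

theorem mem_Fl (m j : ℕ) (h : j < m) : (σ ^ j) a ∈ Fl σ E a m :=
  Subfield.subset_closure (Or.inr ⟨j, h, rfl⟩)

theorem Fl_mono {m m' : ℕ} (h : m ≤ m') : Fl σ E a m ≤ Fl σ E a m' := by
  apply Subfield.closure_mono
  apply Set.union_subset_union_right
  apply Set.image_mono
  intro j hj
  exact lt_of_lt_of_le hj h

theorem notMem_Fl (hE : ∀ z : K, z ∈ E ↔ σ z = z)
    (hinf : ¬ ∃ s : Finset K,
      Subfield.closure ((E : Set K) ∪ Set.range fun n : ℕ => (σ ^ n) a)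
        = Subfield.closure ((E : Set K) ∪ (s : Set K))) (m : ℕ) :
    (σ ^ m) a ∉ Fl σ E a m := by
  intro hmem
  apply hinf
  classical
  refine ⟨(Finset.range m).image (fun n : ℕ => (σ ^ n) a), ?_⟩
  have hset : (((Finset.range m).image (fun n : ℕ => (σ ^ n) a) : Finset K) : Set K) =
      (fun n : ℕ => (σ ^ n) a) '' {j | j < m} := by
    ext z; simp
  rw [hset]
  change _ = Fl σ E a m
  have hst : Fl σ E a m ≤ (Fl σ E a m).comap (σ : K →+* K) := by
    conv_lhs => rw [Fl]
    rw [Subfield.closure_le]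
    rintro z (hz | ⟨j, hj, rfl⟩)
    · change σ z ∈ Fl σ E a m
      rw [(hE z).1 hz]
      exact E_le_Fl σ E a m z hz
    · change σ ((σ ^ j) a) ∈ Fl σ E a m
      have : σ ((σ ^ j) a) = (σ ^ (j + 1)) a := by rw [pow_succ']; rfl
      rw [this]
      rcases Nat.lt_or_ge (j + 1) m with h | h
      · exact mem_Fl σ E a m _ h
      · have : j + 1 = m := le_antisymm hj h
        rw [this]; exact hmem
  have hall : ∀ j, (σ ^ j) a ∈ Fl σ E a m := by
    intro j
    induction j with
    | zero =>
      rcases Nat.eq_zero_or_pos m with h | h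
      · subst h; exact hmem
      · exact mem_Fl σ E a m 0 h
    | succ j ih =>
      rw [pow_succ']
      exact hst ih
  apply le_antisymm
  · rw [Subfield.closure_le]
    rintro z (hz | ⟨j, rfl⟩)
    · exact E_le_Fl σ E a m z hz
    · exact hall j
  · apply Subfield.closure_mono
    apply Set.union_subset_union_right
    rintro _ ⟨j, -, rfl⟩
    exact ⟨j, rfl⟩

theorem indep_block (hnot : ∀ m, (σ ^ m) a ∉ Fl σ E a m) (N n : ℕ) (P : Fin n → K)
    (hP : ∀ i, P i ∈ Fl σ E a N)
    (h : ∑ i, P i * (σ ^ (N + (i : ℕ))) a = 0) : ∀ i, P i = 0 := by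
  by_contra! hc
  obtain ⟨i0, hi0⟩ := hc
  classical
  obtain ⟨i, hi, hmax⟩ := Finset.exists_max_image (Finset.univ.filter fun i => P i ≠ 0) id
    ⟨i0, by simp [hi0]⟩
  have hi : P i ≠ 0 := by simpa using hi
  apply hnot (N + i)
  rw [← Finset.add_sum_erase _ _ (Finset.mem_univ i)] at h
  have heq : (σ ^ (N + (i : ℕ))) a =
      (P i)⁻¹ * -(∑ j ∈ Finset.univ.erase i, P j * (σ ^ (N + (j : ℕ))) a) := by
    rw [eq_inv_mul_iff_mul_eq₀ hi]
    exact eq_neg_of_add_eq_zero_left h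
  rw [heq]
  refine mul_mem (inv_mem (Fl_mono σ E a (by omega) (hP i))) (neg_mem (sum_mem fun j hj => ?_))
  by_cases hj0 : P j = 0
  · rw [hj0, zero_mul]; exact zero_mem _
  · have hle : j ≤ i := hmax j (by simp [hj0])
    have hne : j ≠ i := Finset.ne_of_mem_erase hj
    have : (j : ℕ) < i := lt_of_le_of_ne hle (fun h => hne (Fin.ext h))
    exact mul_mem (Fl_mono σ E a (by omega) (hP j)) (mem_Fl σ E a _ _ (by omega))

theorem evk_mem (n c : ℕ)
    (hτ : ∀ e : E, (σ ^ c) e = e)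
    (hcn : n ≤ c) (k : ℕ) (s : List (Fin n) → E) :
    evk E (σ ^ c) (fun i : Fin n => (σ ^ (i : ℕ)) a) k s ∈ Fl σ E a (c * k) := by
  induction k generalizing s with
  | zero => exact E_le_Fl σ E a _ _ (s []).2
  | succ k ih =>
    rw [evk_last _ _ _ hτ]
    refine sum_mem fun i _ => mul_mem (Fl_mono σ E a (by rw [mul_add]; omega) (ih _)) ?_
    have : ((σ ^ c) ^ k) ((σ ^ (i : ℕ)) a) = (σ ^ (c * k + i)) a := by
      rw [pow_add, pow_mul]; rfl
    rw [this]
    exact mem_Fl σ E a _ _ (by rw [mul_add]; omega)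

theorem evk_inj (hnot : ∀ m, (σ ^ m) a ∉ Fl σ E a m)
    (n c : ℕ) (hτ : ∀ e : E, (σ ^ c) e = e)
    (hcn : n ≤ c) (k : ℕ) (s : List (Fin n) → E)
    (h : evk E (σ ^ c) (fun i : Fin n => (σ ^ (i : ℕ)) a) k s = 0) :
    ∀ w : List (Fin n), w.length = k → s w = 0 := by
  induction k generalizing s with
  | zero =>
    intro w hw
    rw [List.length_eq_zero_iff] at hw
    subst hw
    simpa [evk] using h
  | succ k ih =>
    intro w hw
    rw [evk_last _ _ _ hτ] at h
    have := indep_block σ E a hnot (c * k) n _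
      (fun i => evk_mem σ E a n c hτ hcn k (fun w => s (w ++ [i]))) (by
        rw [← h]
        refine Finset.sum_congr rfl fun i _ => ?_
        congr 1
        rw [pow_add, pow_mul]; rfl)
    obtain ⟨v, i, rfl⟩ : ∃ v i, w = v ++ [i] := by
      rcases List.eq_nil_or_concat w with h | ⟨v, i, h⟩
      · subst h; simp at hw
      · exact ⟨v, i, by simpa using h⟩
    exact ih _ (this i) v (by simpa using hw)

end Field


section Main

variable {K D : Type*} [Field K] [DivisionRing D] [Module K D]

/-- The action of `y⁻¹` on `D × K((y))`. -/
def TP (f : K →+* D) (hsm : ∀ (c : K) (d : D), c • d = f c * d) (τ : K ≃+* K) (y : Dˣ)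
    (hy : ∀ b : K, (y : D) * f b = f (τ b) * (y : D)) :
    (D × (ℤ → K)) →ₛₗ[(τ.symm : K →+* K)] (D × (ℤ → K)) where
  toFun p := (((y⁻¹ : Dˣ) : D) * p.1, shift τ p.2)
  map_add' p q := by ext <;> simp [mul_add]
  map_smul' c p := by
    have h : ((y⁻¹ : Dˣ) : D) * f c = f (τ.symm c) * ((y⁻¹ : Dˣ) : D) := by
      rw [Units.inv_mul_eq_iff_eq_mul, ← mul_assoc, hy, Units.eq_mul_inv_iff_mul_eq]
      simp
    refine Prod.ext ?_ ?_
    · change ((y⁻¹ : Dˣ) : D) * (c • p.1) = (τ.symm c) • (((y⁻¹ : Dˣ) : D) * p.1)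
      rw [hsm, hsm, ← mul_assoc, h, mul_assoc]
    · exact (shift τ).map_smulₛₗ c p.2

/-- The diagonal copy of `K[y⁻¹]`. -/
def Lam (K : Type*) [Field K] [Module K D] (y : Dˣ) : Submodule K (D × (ℤ → K)) :=
  Submodule.span K (Set.range fun k : ℕ =>
    ((((y⁻¹ ^ k : Dˣ) : D), (Pi.single (-(k : ℤ)) (1 : K) : ℤ → K)) : D × (ℤ → K)))

theorem Lam_disj (y : Dˣ) (hli : LinearIndependent K (fun k : ℕ => ((y⁻¹ ^ k : Dˣ) : D)))
    (z : ℤ → K) (h : ((0 : D), z) ∈ Lam K y) : z = 0 := by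
  rw [Lam, Finsupp.mem_span_range_iff_exists_finsupp] at h
  obtain ⟨c, hc⟩ := h
  have h1 := congrArg Prod.fst hc
  have h2 : c = 0 := by
    rw [linearIndependent_iff] at hli
    apply hli
    rw [Finsupp.linearCombination_apply]
    rw [Finsupp.sum, Prod.fst_sum] at h1
    exact h1
  subst h2
  have := congrArg Prod.snd hc
  simpa using this.symm

variable (f : K →+* D) (hsm : ∀ (c : K) (d : D), c • d = f c * d) (τ : K ≃+* K) (y : Dˣ)
    (hy : ∀ b : K, (y : D) * f b = f (τ b) * (y : D))

theorem Lam_stable : Lam K y ≤ (Lam K y).comap (TP f hsm τ y hy) := by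
  conv_lhs => rw [Lam]
  rw [Submodule.span_le]
  rintro _ ⟨k, rfl⟩
  change TP f hsm τ y hy _ ∈ Lam K y
  apply Submodule.subset_span
  refine ⟨k + 1, ?_⟩
  refine Prod.ext ?_ ?_
  · change ((y⁻¹ ^ (k + 1) : Dˣ) : D) = ((y⁻¹ : Dˣ) : D) * ((y⁻¹ ^ k : Dˣ) : D)
    rw [pow_succ', Units.val_mul]
  · funext l
    change (Pi.single (-((k + 1 : ℕ) : ℤ)) (1 : K) : ℤ → K) l =
      τ.symm ((Pi.single (-(k : ℤ)) (1 : K) : ℤ → K) (l + 1))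
    simp only [Pi.single_apply]
    by_cases h : l = -((k + 1 : ℕ) : ℤ)
    · rw [if_pos h, if_pos (by push_cast at h; omega), map_one]
    · rw [if_neg h, if_neg (by push_cast at h; omega), map_zero]

/-- `y⁻¹` on the quotient -/
def TQ : ((D × (ℤ → K)) ⧸ Lam K y) →ₛₗ[(τ.symm : K →+* K)] ((D × (ℤ → K)) ⧸ Lam K y) :=
  Submodule.mapQ _ _ (TP f hsm τ y hy) (Lam_stable f hsm τ y hy)

theorem TQ_mk (p : D × (ℤ → K)) : TQ f hsm τ y hy ((Lam K y).mkQ p) =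
    (Lam K y).mkQ (TP f hsm τ y hy p) := rfl

variable {ι : Type*} [Fintype ι] [DecidableEq ι] (E : Subfield K) (α : ι → K) (A : ι → Dˣ)

theorem TP_rel (hA : ∀ i, (A i : D) = 1 + f (α i) * (y : D))
    (i : ι) (d : D) (s : List ι → E) :
    TP f hsm τ y hy ((A i : D) * d, ev E τ α (fwd i s)) =
      TP f hsm τ y hy (d, ev E τ α s) + τ.symm (α i) • (d, ev E τ α s) := by
  refine Prod.ext ?_ ?_
  · change ((y⁻¹ : Dˣ) : D) * ((A i : D) * d) = ((y⁻¹ : Dˣ) : D) * d + τ.symm (α i) • d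
    rw [hsm, Units.inv_mul_eq_iff_eq_mul, mul_add, Units.mul_inv_cancel_left, ← mul_assoc, hy, hA]
    simp [add_mul]
  · exact ev_fwd E τ α i s

theorem main_locfin (hA : ∀ i, (A i : D) = 1 + f (α i) * (y : D))
    (g : FreeGroup ι) : ∀ (d : D) (s : List ι → E),
    LocFin (TQ f hsm τ y hy) ((Lam K y).mkQ (d, ev E τ α s)) →
    LocFin (TQ f hsm τ y hy)
      ((Lam K y).mkQ (((FreeGroup.lift A g : Dˣ) : D) * d, ev E τ α (Psi ι E g s))) := by
  induction g using FreeGroup.induction_on with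
  | C1 => intro d s h; simpa using h
  | of i =>
    intro d s h
    refine LocFin.step _ _ _ (τ.symm (α i)) 0 h ?_
    have := TP_rel f hsm τ y hy E α A hA i d s
    rw [zero_smul, add_zero, TQ_mk, TQ_mk, ← map_smul, ← map_add, ← this]
    simp [Psi, perm]
  | inv_of i _ =>
    intro d s h
    refine LocFin.step _ _ _ 0 (-τ.symm (α i)) h ?_
    have := TP_rel f hsm τ y hy E α A hA i (((A i)⁻¹ : Dˣ) * d) (bwd i s)
    rw [fwd_bwd, Units.mul_inv_cancel_left] at this
    rw [zero_smul, add_zero, TQ_mk, TQ_mk, this, ← map_smul, ← map_add]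
    simp only [Psi, map_inv, FreeGroup.lift_apply_of]
    change _ = (Lam K y).mkQ (_ + (-τ.symm (α i)) • (((A i)⁻¹ : Dˣ) * d, ev E τ α (bwd i s)))
    rw [neg_smul, add_neg_cancel_right]
    rfl
  | mul g g' h1 h2 =>
    intro d s h
    have := h1 _ _ (h2 _ _ h)
    simpa [mul_assoc] using this

end Main

theorem main_ev {K D : Type*} [Field K] [DivisionRing D] [Module K D] (f : K →+* D)
    (hsm : ∀ (c : K) (d : D), c • d = f c * d) (τ : K ≃+* K) (y : Dˣ)
    (hy : ∀ b : K, (y : D) * f b = f (τ b) * (y : D))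
    {ι : Type*} [Fintype ι] [DecidableEq ι] (E : Subfield K) (α : ι → K) (A : ι → Dˣ)
    (hA : ∀ i, (A i : D) = 1 + f (α i) * (y : D))
    (hli : LinearIndependent K (fun k : ℕ => ((y⁻¹ ^ k : Dˣ) : D)))
    (g : FreeGroup ι) (hg : FreeGroup.lift A g = 1) (k : ℕ) :
    evk E τ α k (Psi ι E g (one ι E)) = evk E τ α k (one ι E) := by
  have hone : ev E τ α (one ι E) = Pi.single 0 1 := by
    funext k
    rcases k with k | k
    · change evk E τ α k _ = _
      cases k with
      | zero => simp [evk, one]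
      | succ k =>
        rw [evk_succ]
        have : ∀ i, (fun w => one ι E (i :: w)) = 0 := fun i => rfl
        simp only [this, evk_zero]
        rw [Pi.single_apply, if_neg (by simp; omega)]
        simp
    · change 0 = _
      rw [Pi.single_apply, if_neg (by simp)]
  have h0 : (Lam K y).mkQ ((1 : D), ev E τ α (one ι E)) = 0 := by
    rw [← LinearMap.mem_ker, Submodule.ker_mkQ, hone]
    exact Submodule.subset_span ⟨0, by simp⟩
  have h1 := main_locfin f hsm τ y hy E α A hA g 1 (one ι E) (by rw [h0]; exact LocFin.zero _)
  rw [hg, Units.val_one, one_mul] at h1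
  set z : ℤ → K := ev E τ α (Psi ι E g (one ι E)) - ev E τ α (one ι E) with hz
  have h2 : (Lam K y).mkQ ((1 : D), ev E τ α (Psi ι E g (one ι E))) =
      (Lam K y).mkQ ((0 : D), z) := by
    rw [← sub_zero ((Lam K y).mkQ ((1 : D), ev E τ α (Psi ι E g (one ι E)))), ← h0, ← map_sub]
    simp [hz]
  rw [h2] at h1
  by_contra hne
  have hzk : z (k : ℤ) ≠ 0 := sub_ne_zero.mpr hne
  have hneg : ∀ l : ℤ, l < 0 → z l = 0 := by
    intro l hl
    obtain ⟨m, rfl⟩ := Int.eq_negSucc_of_lt_zero hl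
    exact sub_zero _
  classical
  have hex : ∃ k : ℕ, z (k : ℤ) ≠ 0 := ⟨k, hzk⟩
  have hLI := shift_li τ z (Nat.find hex : ℤ) (Nat.find_spec hex) (by
    intro l hl
    by_cases hl0 : l < 0
    · exact hneg l hl0
    · obtain ⟨m, rfl⟩ := Int.eq_ofNat_of_zero_le (not_lt.mp hl0)
      have := Nat.find_min hex (m := m) (by exact_mod_cast hl)
      simpa using this)
  have hLI2 := hLI.map' ((Lam K y).mkQ ∘ₗ LinearMap.inr K D (ℤ → K)) (by
    rw [LinearMap.ker_eq_bot']
    intro m hm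
    apply Lam_disj y hli
    have : (Lam K y).mkQ ((0 : D), m) = 0 := hm
    rwa [← LinearMap.mem_ker, Submodule.ker_mkQ] at this)
  refine LocFin.not_li _ _ h1 _ rfl ?_ hLI2
  intro k
  simp only [Function.comp_apply, Function.iterate_succ_apply', LinearMap.comp_apply]
  change (Lam K y).mkQ ((0 : D), _) = (Lam K y).mkQ (TP f hsm τ y hy ((0 : D), _))
  congr 1
  refine Prod.ext ?_ rfl
  exact (mul_zero _).symm

end Stmt9


/-- Abstract setting for `D = K(x,σ)`: a division ring containing `K` via `f`, with a
unit `x` satisfying the skew relation, the powers of `x` being left linearly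
independent over `K`.  If `E(σⁿ(a) : n)` is infinitely generated over the fixed field
`E`, then `A i = 1 + σ^i(a) x^{2n}`, `0 ≤ i ≤ n`, freely generate a free subgroup of
`Dˣ` of rank `n+1`. -/
theorem stmt9 {K D : Type*} [Field K] [DivisionRing D] (σ : K ≃+* K)
    (f : K →+* D) (hf : Function.Injective f) (x : Dˣ)
    (hskew : ∀ b : K, (x : D) * f b = f (σ b) * (x : D))
    (hbasis : ∀ (m : ℕ) (g : ℕ → K),
      (∑ i ∈ Finset.range m, f (g i) * (x : D) ^ i) = 0 → ∀ i < m, g i = 0)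
    (E : Subfield K) (hE : ∀ z : K, z ∈ E ↔ σ z = z) (a : K)
    (hinf : ¬ ∃ s : Finset K,
      Subfield.closure ((E : Set K) ∪ Set.range fun n : ℕ => (σ ^ n) a)
        = Subfield.closure ((E : Set K) ∪ (s : Set K)))
    (n : ℕ) (hn : 1 ≤ n)
    (A : Fin (n + 1) → Dˣ)
    (hA : ∀ i, (A i : D) = 1 + f ((σ ^ (i : ℕ)) a) * (x : D) ^ (2 * n)) :
    Function.Injective (FreeGroup.lift A : FreeGroup (Fin (n + 1)) →* Dˣ) := by
  classical
  let : Module K D := Module.compHom D f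
  have hsm : ∀ (c : K) (d : D), c • d = f c * d := fun _ _ => rfl
  have hpow : ∀ (k : ℕ) (b : K), ((x ^ k : Dˣ) : D) * f b = f ((σ ^ k) b) * ((x ^ k : Dˣ) : D) := by
    intro k
    induction k with
    | zero => intro b; simp
    | succ k ih =>
      intro b
      rw [pow_succ, Units.val_mul, mul_assoc, hskew, ← mul_assoc, ih, mul_assoc, pow_succ]
      rfl
  have hx : LinearIndependent K (fun k : ℕ => (x : D) ^ k) := by
    rw [linearIndependent_iff']
    intro s g hg i hi
    obtain ⟨m, hm⟩ := s.exists_nat_subset_range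
    have := hbasis m (fun j => if j ∈ s then g j else 0) (by
      rw [← hg, ← Finset.sum_subset hm]
      · refine Finset.sum_congr rfl fun j hj => ?_
        rw [if_pos hj]; rfl
      · intro j _ hj
        simp [hj]) i (by simpa using hm hi)
    simpa [hi] using this
  have hli : LinearIndependent K (fun k : ℕ => (((x ^ (2 * n))⁻¹ ^ k : Dˣ) : D)) := by
    rw [linearIndependent_iff']
    intro s g hg
    obtain ⟨m, hm⟩ := s.exists_nat_subset_range
    have hlt : ∀ i ∈ s, i < m := fun i hi => by simpa using hm hi
    have hcomp : LinearIndependent K (fun k : s => (x : D) ^ (2 * n * (m - (k : ℕ)))) := by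
      refine hx.comp (fun k : s => 2 * n * (m - (k : ℕ))) ?_
      intro k l hkl
      have h1 := Nat.eq_of_mul_eq_mul_left (by omega) hkl
      have := hlt k k.2
      have := hlt l l.2
      exact Subtype.ext (by omega)
    rw [Fintype.linearIndependent_iff] at hcomp
    have h0 := congrArg (fun d : D => d * (((x ^ (2 * n)) ^ m : Dˣ) : D)) hg
    simp only [Finset.sum_mul, zero_mul] at h0
    have := hcomp (fun k => g k) (by
      rw [← h0, ← Finset.sum_coe_sort s]
      refine Finset.sum_congr rfl fun k _ => ?_
      rw [hsm, hsm, mul_assoc (f _), ← Units.val_mul]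
      congr 1
      rw [← Units.val_pow_eq_pow_val]
      congr 1
      rw [inv_pow, eq_inv_mul_iff_mul_eq, pow_mul x (2 * n), ← pow_add]
      congr 1
      have := hlt k k.2
      omega)
    intro i hi
    exact this ⟨i, hi⟩
  have hτ : ∀ e : E, (σ ^ (2 * n)) (e : K) = e := by
    intro e
    have he := (hE e).1 e.2
    generalize 2 * n = k
    induction k with
    | zero => rfl
    | succ k ih => rw [pow_succ', RingAut.mul_apply, ih, he]
  rw [injective_iff_map_eq_one]
  intro g hg
  have hev := Stmt9.main_ev f hsm (σ ^ (2 * n)) (x ^ (2 * n)) (hpow (2 * n)) E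
    (fun i : Fin (n + 1) => (σ ^ (i : ℕ)) a) A (by intro i; rw [hA]; simp) hli g hg
  have hnot := Stmt9.notMem_Fl σ E a hE hinf
  refine Stmt9.Psi_one_ne (F := E) g ?_ (0 : Fin (n + 1)) (Fin.last n) ?_
  · funext w
    have := Stmt9.evk_inj σ E a hnot (n + 1) (2 * n) hτ (by omega) w.length
      (Stmt9.Psi (Fin (n + 1)) E g (Stmt9.one (Fin (n + 1)) E) - Stmt9.one (Fin (n + 1)) E)
      (by rw [Stmt9.evk_sub, hev, sub_self]) w rfl
    exact sub_eq_zero.mp this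
  · intro h
    have := congrArg Fin.val h
    simp at this
    omega
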